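/- Let K be an algebraically closed field of characteristic zero, let A be an integral domain which is a finitely generated K-algebra, and let A' be the integral closure of A in F = Frac(A). Let r ≥ 0, let φ : ⋀^r_A Ω_{A/K} → A be an A-linear map, and let φ' : ⋀^r_{A'} Ω_{A'/K} → A' be an A'-linear map which lifts φ, i.e. φ'(μ(ω)) = φ(ω) for all ω ∈ ⋀^r_A Ω_{A/K}, where μ : ⋀^r_A Ω_{A/K} → ⋀^r_{A'} Ω_{A'/K} is the canonical map induced by the inclusion A ⊆ A'. Suppose p ⊂ A is a prime ideal of height one such that the image of φ is contained in p. Then for every prime ideal q of A' lying over p (i.e. with q ∩ A = p), the image of φ' is contained in q. -/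

import Mathlib

open Polynomial

/-- A multilinear map with values in a prime `q` on a set `S` has all its values in `q` as soon as
`S` generates the module after localizing at `q`. -/
theorem MultilinearMap.map_mem_of_smul_mem_span {B M ι : Type*} [CommRing B] [AddCommGroup M]
    [Module B M] [Fintype ι] (g : MultilinearMap B (fun _ : ι => M) B) {q : Ideal B}
    (hq : q.IsPrime) {S : Set M} (hg : ∀ v : ι → M, (∀ i, v i ∈ S) → g v ∈ q)
    (hS : ∀ m, ∃ s ∉ q, s • m ∈ Submodule.span B S) (v : ι → M) : g v ∈ q := by
  classical
  suffices H : ∀ (I : Finset ι) (v : ι → M), (∀ i ∉ I, v i ∈ S) → g v ∈ q from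
    H Finset.univ v fun i hi => absurd (Finset.mem_univ i) hi
  intro I
  induction I using Finset.induction_on with
  | empty => exact fun v hv => hg v fun i => hv i (Finset.notMem_empty i)
  | insert i I _ ih =>
    intro v hv
    have hspan : Submodule.span B S ≤ Submodule.comap (g.toLinearMap v i) q := by
      refine Submodule.span_le.2 fun x hx => ih _ fun j hj => ?_
      by_cases hji : j = i
      · subst hji; simpa using hx
      · simpa [Function.update_of_ne hji] using hv j (by simp [hji, hj])
    obtain ⟨s, hs, hsm⟩ := hS (v i)
    have := hspan hsm
    rw [Submodule.mem_comap, map_smul, g.toLinearMap_apply, Function.update_eq_self,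
      smul_eq_mul] at this
    exact (hq.mem_or_mem this).resolve_left hs

section

variable {K A B : Type*} [Field K] [CommRing A] [CommRing B] [Algebra K B] [Algebra A B]

theorem KaehlerDifferential.D_aeval_sub_mem_span (f : A[X]) (b : B) :
    KaehlerDifferential.D K B (aeval b f) - aeval b (derivative f) • KaehlerDifferential.D K B b ∈
      Submodule.span B (Set.range fun a : A => KaehlerDifferential.D K B (algebraMap A B a)) := by
  induction f using Polynomial.induction_on' with
  | add f g hf hg =>
    convert! add_mem hf hg using 1
    simp only [map_add, add_smul]
    abel
  | monomial n a =>
    have : KaehlerDifferential.D K B (aeval b (monomial n a)) -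
        aeval b (derivative (monomial n a)) • KaehlerDifferential.D K B b =
        b ^ n • KaehlerDifferential.D K B (algebraMap A B a) := by
      simp only [aeval_monomial, derivative_monomial, Derivation.leibniz, Derivation.leibniz_pow,
        map_mul, map_natCast, mul_smul, ← Nat.cast_smul_eq_nsmul B]
      module
    rw [this]
    exact Submodule.smul_mem _ _ (Submodule.subset_span ⟨a, rfl⟩)

theorem Ideal.natCast_notMem_of_charZero [CharZero K] {q : Ideal B} (hq : q ≠ ⊤) {n : ℕ}
    (hn : n ≠ 0) : (n : B) ∉ q := fun h => hq <| q.eq_top_of_isUnit_mem h <| by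
  rw [← map_natCast (algebraMap K B)]
  exact (IsUnit.mk0 (n : K) (Nat.cast_ne_zero.2 hn)).map _

variable (K) in
/-- In characteristic zero the residue extension of an integral extension is separable. -/
theorem Ideal.exists_aeval_mem_aeval_derivative_notMem [CharZero K] [Algebra.IsIntegral A B]
    {q : Ideal B} (hq : q.IsPrime) (b : B) :
    ∃ f : A[X], aeval b f ∈ q ∧ aeval b (derivative f) ∉ q := by
  classical
  let p := q.comap (algebraMap A B)
  have hp : p.IsPrime := hq.comap _
  have hex : ∃ n, ∃ f : A[X], f.natDegree ≤ n ∧ f.coeff n ∉ p ∧ aeval b f ∈ q := by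
    obtain ⟨f, hf, hfb⟩ := Algebra.IsIntegral.isIntegral (R := A) b
    refine ⟨f.natDegree, f, le_rfl, ?_, ?_⟩
    · rw [hf.coeff_natDegree]
      exact fun h => hp.ne_top ((Ideal.eq_top_iff_one _).2 h)
    · rw [aeval_def, hfb]
      exact q.zero_mem
  obtain ⟨f, hfn, hfp, hfb⟩ := Nat.find_spec hex
  refine ⟨f, hfb, fun hder => ?_⟩
  rcases hn : Nat.find hex with _ | n
  · rw [hn] at hfn hfp
    rw [eq_C_of_natDegree_le_zero hfn, aeval_C] at hfb
    exact hfp hfb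
  · rw [hn] at hfn hfp
    refine Nat.find_min hex (m := n) (by omega) ⟨derivative f, ?_, ?_, hder⟩
    · exact (natDegree_derivative_le f).trans (by omega)
    · rw [coeff_derivative]
      intro h
      refine (hp.mem_or_mem h).elim hfp fun h => ?_
      exact Ideal.natCast_notMem_of_charZero (K := K) hq.ne_top n.succ_ne_zero
        (by simpa [p] using h)

/-- If `t` is a uniformizer at `q` and the derivation `δ` maps `A` into `q ∩ A`, then `δ t ∈ q`.
The proof differentiates `s * a = u * t ^ e` for an `a ∈ q ∩ A` of least valuation `e`. -/
theorem Derivation.map_uniformizer_mem [CharZero K] [IsDomain B] {q : Ideal B} (hq : q.IsPrime)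
    {t : B} (ht0 : t ≠ 0) (ht : t ∈ q)
    (hval : ∀ x : B, x ≠ 0 → ∃ (n : ℕ) (s u : B), s ∉ q ∧ u ∉ q ∧ s * x = u * t ^ n)
    (hq0 : ∃ a : A, algebraMap A B a ∈ q ∧ algebraMap A B a ≠ 0)
    (δ : Derivation K B B)
    (hδ : ∀ a : A, ∃ x : A, algebraMap A B x ∈ q ∧ δ (algebraMap A B a) = algebraMap A B x) :
    δ t ∈ q := by
  classical
  have hex : ∃ n, ∃ (a : A) (s u : B), algebraMap A B a ∈ q ∧ s ∉ q ∧ u ∉ q ∧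
      s * algebraMap A B a = u * t ^ n := by
    obtain ⟨a, haq, ha0⟩ := hq0
    obtain ⟨n, s, u, hs, hu, h⟩ := hval _ ha0
    exact ⟨n, a, s, u, haq, hs, hu, h⟩
  obtain ⟨a, s, u, haq, hs, hu, hsu⟩ := Nat.find_spec hex
  obtain ⟨e, he⟩ : ∃ e, Nat.find hex = e + 1 := by
    refine Nat.exists_eq_succ_of_ne_zero fun h0 => hu ?_
    rw [h0, pow_zero, mul_one] at hsu
    exact hsu ▸ q.mul_mem_left _ haq
  have hdiv : ∀ x : A, algebraMap A B x ∈ q →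
      ∃ s y : B, s ∉ q ∧ s * algebraMap A B x = t ^ (e + 1) * y := by
    intro x hx
    by_cases hx0 : algebraMap A B x = 0
    · exact ⟨1, 0, fun h => hq.ne_top ((Ideal.eq_top_iff_one _).2 h), by simp [hx0]⟩
    obtain ⟨n, s, u, hs, hu, h⟩ := hval _ hx0
    have hn : e + 1 ≤ n := he ▸ Nat.find_min' hex ⟨x, s, u, hx, hs, hu, h⟩
    obtain ⟨k, rfl⟩ := Nat.exists_eq_add_of_le hn
    exact ⟨s, u * t ^ k, hs, by rw [h, pow_add]; ring⟩
  rw [he] at hsu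
  obtain ⟨a', ha'q, ha'⟩ := hδ a
  obtain ⟨s₁, y₁, hs₁, h₁⟩ := hdiv a haq
  obtain ⟨s₂, y₂, hs₂, h₂⟩ := hdiv a' ha'q
  have hd := congrArg δ hsu
  simp only [Derivation.leibniz, Derivation.leibniz_pow, ha', smul_eq_mul, nsmul_eq_mul,
    Nat.add_sub_cancel] at hd
  have key : t ^ e * (s₁ * s₂ * u * ((e + 1 : ℕ) : B) * δ t) =
      t ^ e * (t * (s₁ * s * y₂ + s₂ * y₁ * δ s - s₁ * s₂ * δ u)) := by
    linear_combination (-s₁ * s₂) * hd + s₁ * s * h₂ + s₂ * δ s * h₁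
  have hmem := mul_left_cancel₀ (pow_ne_zero e ht0) key ▸ q.mul_mem_right _ ht
  refine (hq.mem_or_mem hmem).resolve_left fun h => ?_
  refine (hq.mem_or_mem h).elim (fun h => ?_)
    (Ideal.natCast_notMem_of_charZero (K := K) hq.ne_top e.succ_ne_zero)
  rcases hq.mem_or_mem h with h | h
  · exact (hq.mem_or_mem h).elim hs₁ hs₂
  · exact hu h

/-- Modulo `q`, and after localizing at `q`, the Kähler differentials of an integral extension `B`
of `A` are generated by the differentials of elements of `A` and of a uniformizer `t`. -/
theorem KaehlerDifferential.exists_smul_mem_span [CharZero K] [Algebra.IsIntegral A B]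
    {q : Ideal B} (hq : q.IsPrime) {t : B} (ht : t ∈ q)
    (hgen : ∀ x ∈ q, ∃ s y : B, s ∉ q ∧ s * x = y * t) (ω : Ω[B⁄K]) :
    ∃ s ∉ q, s • ω ∈ Submodule.span B
      ((Set.range fun a : A => KaehlerDifferential.D K B (algebraMap A B a)) ∪
        {KaehlerDifferential.D K B t} ∪ {η | ∃ c ∈ q, ∃ θ : Ω[B⁄K], η = c • θ}) := by
  set S := (Set.range fun a : A => KaehlerDifferential.D K B (algebraMap A B a)) ∪
        {KaehlerDifferential.D K B t} ∪ {η | ∃ c ∈ q, ∃ θ : Ω[B⁄K], η = c • θ}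
  have hω : ω ∈ Submodule.span B (Set.range (KaehlerDifferential.D K B)) := by
    rw [KaehlerDifferential.span_range_derivation]
    trivial
  have h1 : (1 : B) ∉ q := fun h => hq.ne_top ((Ideal.eq_top_iff_one _).2 h)
  have hmul : ∀ {x y : B}, x ∉ q → y ∉ q → x * y ∉ q := fun hx hy h =>
    (hq.mem_or_mem h).elim hx hy
  have hqS : ∀ c ∈ q, ∀ θ : Ω[B⁄K], c • θ ∈ Submodule.span B S := fun c hc θ =>
    Submodule.subset_span (Or.inr ⟨c, hc, θ, rfl⟩)
  induction hω using Submodule.span_induction with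
  | zero => exact ⟨1, h1, by simp⟩
  | add x y _ _ hx hy =>
    obtain ⟨s₁, hs₁, hx⟩ := hx
    obtain ⟨s₂, hs₂, hy⟩ := hy
    refine ⟨s₁ * s₂, hmul hs₁ hs₂, ?_⟩
    convert! add_mem (Submodule.smul_mem _ s₂ hx) (Submodule.smul_mem _ s₁ hy) using 1
    module
  | smul c x _ hx =>
    obtain ⟨s, hs, hx⟩ := hx
    refine ⟨s, hs, ?_⟩
    rw [smul_comm]
    exact Submodule.smul_mem _ c hx
  | mem x hx =>
    obtain ⟨b, rfl⟩ := hx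
    obtain ⟨f, hfb, hf'⟩ := Ideal.exists_aeval_mem_aeval_derivative_notMem K (A := A) hq b
    obtain ⟨s, y, hs, hsy⟩ := hgen _ hfb
    have htq : t • KaehlerDifferential.D K B y - aeval b f • KaehlerDifferential.D K B s ∈
        Submodule.span B S := sub_mem (hqS t ht _) (hqS _ hfb _)
    refine ⟨s * aeval b (derivative f), hmul hs hf', ?_⟩
    have hd := congrArg (KaehlerDifferential.D K B) hsy
    rw [Derivation.leibniz, Derivation.leibniz] at hd
    have hA := Submodule.span_mono (t := S) (fun _ h => Or.inl (Or.inl h))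
      (KaehlerDifferential.D_aeval_sub_mem_span (K := K) f b)
    have hDt : KaehlerDifferential.D K B t ∈ Submodule.span B S :=
      Submodule.subset_span (Or.inl (Or.inr rfl))
    convert! sub_mem (add_mem (Submodule.smul_mem _ y hDt) htq) (Submodule.smul_mem _ s hA) using 1
    rw [smul_sub, mul_smul, eq_sub_of_add_eq hd]
    module


/-- An alternating form on `Ω[B⁄K]` that maps the differentials of `A` into `q ∩ A` has all its
values in `q`, provided that `B` is integral over `A` and `q` has a uniformizer. -/
theorem AlternatingMap.apply_kaehlerDifferential_mem [CharZero K] [IsDomain B]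
    [Algebra.IsIntegral A B] {q : Ideal B} (hq : q.IsPrime)
    {t : B} (ht0 : t ≠ 0) (ht : t ∈ q)
    (hval : ∀ x : B, x ≠ 0 → ∃ (n : ℕ) (s u : B), s ∉ q ∧ u ∉ q ∧ s * x = u * t ^ n)
    (hq0 : ∃ a : A, algebraMap A B a ∈ q ∧ algebraMap A B a ≠ 0)
    {ι : Type*} [Fintype ι] (g : Ω[B⁄K] [⋀^ι]→ₗ[B] B)
    (hg : ∀ a : ι → A, ∃ x : A, algebraMap A B x ∈ q ∧
      g (fun i => KaehlerDifferential.D K B (algebraMap A B (a i))) = algebraMap A B x)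
    (v : ι → Ω[B⁄K]) : g v ∈ q := by
  classical
  have hgen : ∀ x ∈ q, ∃ s y : B, s ∉ q ∧ s * x = y * t := by
    intro x hx
    by_cases hx0 : x = 0
    · exact ⟨1, 0, fun h => hq.ne_top ((Ideal.eq_top_iff_one _).2 h), by simp [hx0]⟩
    obtain ⟨n, s, u, hs, hu, h⟩ := hval x hx0
    cases n with
    | zero =>
      rw [pow_zero, mul_one] at h
      exact absurd (h ▸ q.mul_mem_left s hx) hu
    | succ n => exact ⟨s, u * t ^ n, hs, by rw [h, pow_succ, mul_assoc]⟩
  refine g.toMultilinearMap.map_mem_of_smul_mem_span hq (fun v hv => ?_)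
    (KaehlerDifferential.exists_smul_mem_span (A := A) hq ht hgen) v
  change g v ∈ q
  by_cases hc : ∃ i, ∃ c ∈ q, ∃ θ : Ω[B⁄K], v i = c • θ
  · obtain ⟨i, c, hc, θ, hi⟩ := hc
    rw [← Function.update_eq_self i v, hi, g.map_update_smul]
    exact q.mul_mem_right _ hc
  have hv' : ∀ i, (∃ a : A, KaehlerDifferential.D K B (algebraMap A B a) = v i) ∨
      v i = KaehlerDifferential.D K B t := fun i =>
    (hv i).resolve_right fun h => hc ⟨i, h⟩
  by_cases hex : ∃ i, v i = KaehlerDifferential.D K B t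
  · obtain ⟨i, hi⟩ := hex
    by_cases hij : ∃ j, j ≠ i ∧ v j = KaehlerDifferential.D K B t
    · obtain ⟨j, hji, hj⟩ := hij
      rw [g.map_eq_zero_of_eq v (hj.trans hi.symm) hji]
      exact q.zero_mem
    have hv'' : ∀ j, ∃ a : A, j ≠ i → KaehlerDifferential.D K B (algebraMap A B a) = v j := by
      intro j
      rcases hv' j with ⟨a, ha⟩ | h
      · exact ⟨a, fun _ => ha⟩
      · exact ⟨0, fun hji => absurd ⟨j, hji, h⟩ hij⟩
    choose a ha using hv''
    have := Derivation.map_uniformizer_mem hq ht0 ht hval hq0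
      ((g.toMultilinearMap.toLinearMap v i).compDer (KaehlerDifferential.D K B)) fun b => by
        obtain ⟨x, hx, h⟩ := hg (Function.update a i b)
        refine ⟨x, hx, ?_⟩
        rw [← h]
        change g _ = g _
        congr 1
        funext j
        by_cases hji : j = i
        · subst hji; simp
        · simp [Function.update_of_ne hji, ha j hji]
    change g (Function.update v i (KaehlerDifferential.D K B t)) ∈ q at this
    rwa [← hi, Function.update_eq_self] at this
  · choose a ha using fun i => (hv' i).resolve_right fun h => hex ⟨i, h⟩
    obtain ⟨x, hx, h⟩ := hg a
    rw [← funext ha, h]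
    exact hx

end

theorem Ideal.exists_uniformizer_of_height_one {B : Type*} [CommRing B] [IsDomain B]
    [IsNoetherianRing B] [IsIntegrallyClosed B] {q : Ideal B} (hq : q.IsPrime) (hq0 : q ≠ ⊥)
    (hmin : ∀ P : Ideal B, P.IsPrime → P < q → P = ⊥) :
    ∃ t ∈ q, t ≠ 0 ∧
      ∀ x : B, x ≠ 0 → ∃ (n : ℕ) (s u : B), s ∉ q ∧ u ∉ q ∧ s * x = u * t ^ n := by
  let L := Localization.AtPrime q
  have hinj : Function.Injective (algebraMap B L) :=
    IsLocalization.injective L q.primeCompl_le_nonZeroDivisors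
  have : IsNoetherianRing L := IsLocalization.isNoetherianRing q.primeCompl L inferInstance
  have : IsIntegrallyClosed L :=
    isIntegrallyClosed_of_isLocalization L q.primeCompl q.primeCompl_le_nonZeroDivisors
  have hmax : ∀ P : Ideal L, P ≠ ⊥ → P.IsPrime → P = IsLocalRing.maximalIdeal L := by
    intro P hP hPp
    have hle : P.comap (algebraMap B L) ≤ q := by
      refine (Ideal.comap_mono (IsLocalRing.le_maximalIdeal hPp.ne_top)).trans_eq ?_
      exact Localization.AtPrime.under_maximalIdeal (I := q)
    refine (Localization.AtPrime.eq_maximalIdeal_iff_under_eq (I := q)).1 ?_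
    refine hle.eq_of_not_lt fun hlt => hP ?_
    rw [← IsLocalization.map_under q.primeCompl L P, hmin (P.under B) (hPp.comap _) hlt,
      Ideal.map_bot]
  have hnf : IsLocalRing.maximalIdeal L ≠ ⊥ := by
    obtain ⟨x, hx, hx0⟩ := Submodule.exists_mem_ne_zero_of_ne_bot hq0
    intro h
    have := (IsLocalization.AtPrime.to_map_mem_maximal_iff L q x).2 hx
    rw [h, Ideal.mem_bot, map_eq_zero_iff _ hinj] at this
    exact hx0 this
  have : IsPrincipalIdealRing L :=
    ((tfae_of_isNoetherianRing_of_isLocalRing_of_isDomain L).out 0 3 :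
      _ ↔ IsIntegrallyClosed L ∧
        ∀ P : Ideal L, P ≠ ⊥ → P.IsPrime → P = IsLocalRing.maximalIdeal L).2 ⟨inferInstance, hmax⟩
  have : IsDiscreteValuationRing L := { not_a_field' := hnf }
  obtain ⟨ϖ, hϖ⟩ := IsDiscreteValuationRing.exists_irreducible L
  obtain ⟨⟨t, d⟩, htd⟩ := IsLocalization.surj q.primeCompl ϖ
  have hd := IsLocalization.map_units L d
  have hass : Associated ϖ (algebraMap B L t) := ⟨hd.unit, htd⟩
  have htirr := hass.irreducible hϖ
  refine ⟨t, ?_, ?_, fun x hx => ?_⟩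
  · by_contra h
    exact htirr.not_isUnit ((IsLocalization.AtPrime.isUnit_to_map_iff L q t).2 h)
  · rintro rfl
    exact htirr.ne_zero (map_zero _)
  · obtain ⟨n, w, hw⟩ := IsDiscreteValuationRing.eq_unit_mul_pow_irreducible
      ((map_ne_zero_iff _ hinj).2 hx) htirr
    obtain ⟨⟨u, s⟩, hus⟩ := IsLocalization.surj q.primeCompl (w : L)
    refine ⟨n, s, u, s.2, ?_, hinj ?_⟩
    · refine (IsLocalization.AtPrime.isUnit_to_map_iff L q u).1 ?_
      rw [← hus]
      exact w.isUnit.mul (IsLocalization.map_units L s)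
    · rw [map_mul, map_mul, map_pow, hw, ← hus]
      ring

/-- The normalisation of a finitely generated domain over a field of characteristic zero is
Noetherian. -/
theorem isNoetherianRing_integralClosure_of_finiteType (K : Type*) [Field K] [CharZero K]
    (A : Type*) [CommRing A] [IsDomain A] [Algebra K A] [Algebra.FiniteType K A]
    (F : Type*) [Field F] [Algebra A F] [IsFractionRing A F] :
    IsNoetherianRing (integralClosure A F) := by
  obtain ⟨s, g, hg, hfin⟩ := exists_finite_inj_algHom_of_fg K A
  let R := MvPolynomial (Fin s) K
  have hfin' : g.toRingHom.Finite := hfin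
  algebraize [g.toRingHom, (algebraMap A F).comp g.toRingHom]
  have : FaithfulSMul R A := (faithfulSMul_iff_algebraMap_injective R A).2 hg
  have : FaithfulSMul R F := FaithfulSMul.trans R A F
  let := FractionRing.liftAlgebra R F
  have : Module.Finite (FractionRing R) F := .of_isLocalization R A (nonZeroDivisors R)
  have : CharZero (FractionRing R) :=
    charZero_of_injective_algebraMap (IsFractionRing.injective R (FractionRing R))
  have : IsIntegralClosure (integralClosure A F) R F :=
    { algebraMap_injective := Subtype.val_injective
      isIntegral_iff := fun {x} =>
        ⟨fun hx => ⟨⟨x, hx.tower_top⟩, rfl⟩, by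
          rintro ⟨y, rfl⟩
          exact isIntegral_trans (A := A) _ y.2⟩ }
  exact IsIntegralClosure.isNoetherianRing R (FractionRing R) F (integralClosure A F)


/-- The wedge product `v 0 ∧ ⋯ ∧ v (n-1)` of a family of vectors, as an element of the
`n`-th exterior power `⋀[R]^n M`. -/
noncomputable def wedgeιMulti (R : Type*) [CommRing R] {M : Type*} [AddCommGroup M] [Module R M]
    (n : ℕ) (v : Fin n → M) : ⋀[R]^n M :=
  ⟨ExteriorAlgebra.ιMulti R n v, ExteriorAlgebra.ιMulti_range R n ⟨v, rfl⟩⟩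

set_option synthInstance.maxHeartbeats 1000000 in
set_option maxHeartbeats 2000000 in
/-- **Vanishing of the lifted Pfaff field along the preimage of a height-one prime.**

Let `K` be an algebraically closed field of characteristic zero, `A` an integral domain which
is a finitely generated `K`-algebra, `F = Frac(A)` and `A' = integralClosure A F` the
normalisation.  Let `φ : ⋀^r_A Ω_{A/K} → A` be an `A`-linear map and let
`φ' : ⋀^r_{A'} Ω_{A'/K} → A'` be an `A'`-linear lift of `φ`, i.e. `φ'` is compatible with
`φ` via the canonical map `μ` induced by `A ⊆ A'`; since both `φ' ∘ μ` and `φ` are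
`A`-linear and the wedges `d a_1 ∧ ⋯ ∧ d a_r` with `a j ∈ A` generate `⋀^r_A Ω_{A/K}` as an
`A`-module, this compatibility is expressed by agreement on these generators.
If `p ⊂ A` is a height-one prime (i.e. `p` is a nonzero prime and every prime strictly
contained in `p` is zero) containing the image of `φ`, then every prime `q` of `A'` lying
over `p` contains the image of `φ'`. -/
theorem lifted_pfaff_vanishes_along_preimage
    (K : Type*) [Field K] [IsAlgClosed K] [CharZero K]
    (A : Type*) [CommRing A] [IsDomain A] [Algebra K A] [Algebra.FiniteType K A]
    (F : Type*) [Field F] [Algebra A F] [IsFractionRing A F]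
    [Algebra K F] [IsScalarTower K A F]
    (r : ℕ)
    (φ : ↥(⋀[A]^r (Ω[A⁄K])) →ₗ[A] A)
    (φ' : ↥(⋀[↥(integralClosure A F)]^r (Ω[↥(integralClosure A F)⁄K]))
            →ₗ[↥(integralClosure A F)] ↥(integralClosure A F))
    (hlift : ∀ a : Fin r → A,
      φ' (wedgeιMulti ↥(integralClosure A F) r
            (fun j => KaehlerDifferential.D K ↥(integralClosure A F)
              (algebraMap A ↥(integralClosure A F) (a j))))
        = algebraMap A ↥(integralClosure A F)
            (φ (wedgeιMulti A r (fun j => KaehlerDifferential.D K A (a j)))))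
    (p : Ideal A) (hp : p.IsPrime) (hp0 : p ≠ ⊥)
    (hht : ∀ q : Ideal A, q.IsPrime → q < p → q = ⊥)
    (hφ : ∀ ω, φ ω ∈ p)
    (q : Ideal ↥(integralClosure A F)) (hq : q.IsPrime)
    (hlying : Ideal.comap (algebraMap A ↥(integralClosure A F)) q = p) :
    ∀ ω', φ' ω' ∈ q := by
  have hnoeth := isNoetherianRing_integralClosure_of_finiteType K A F
  have hclosed : IsIntegrallyClosed (integralClosure A F) :=
    integralClosure.isIntegrallyClosedOfFiniteExtension F
  have hinj : Function.Injective (algebraMap A (integralClosure A F)) :=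
    FaithfulSMul.algebraMap_injective _ _
  obtain ⟨a, ha, ha0⟩ := Submodule.exists_mem_ne_zero_of_ne_bot hp0
  have ha0' := (map_ne_zero_iff _ hinj).2 ha0
  have hmem : ∀ {x : A}, x ∈ p → algebraMap A (integralClosure A F) x ∈ q := fun {x} hx => by
    rwa [← hlying] at hx
  have hq0 : q ≠ ⊥ := by
    rintro rfl
    exact ha0' (hmem ha)
  obtain ⟨t, ht, ht0, hval⟩ := Ideal.exists_uniformizer_of_height_one hq hq0 fun P hP hPq =>
    Ideal.eq_bot_of_comap_eq_bot
      (hht _ (hP.comap _) (hlying ▸ Ideal.IsIntegral.comap_lt_comap hPq))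
  have hg := AlternatingMap.apply_kaehlerDifferential_mem (A := A) hq ht0 ht hval
    ⟨a, hmem ha, ha0'⟩ (φ'.compAlternatingMap (exteriorPower.ιMulti (integralClosure A F) r))
    fun a => ⟨_, hmem (hφ _), hlift a⟩
  intro ω'
  have hω' : ω' ∈ Submodule.span (integralClosure A F)
      (Set.range (exteriorPower.ιMulti (integralClosure A F) r)) := by
    rw [exteriorPower.ιMulti_span]
    trivial
  refine (Submodule.span_le (p := Submodule.comap φ' q)).2 ?_ hω'
  rintro _ ⟨v, rfl⟩
  exact hg v
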